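/- arXiv:1901.08034 — 4 statements merged into one kernel-verified Lean document; each statement's English description precedes it below -/
import Mathlib

section
/- Let B₀, C₁ ∈ ℂ with C₁ ≠ 0, let a⁰₀ ∈ ℂ², let a¹ : ℕ → ℂ², let Ψ : ℕ → ℂ², and let C : {1,2,3,…} → ℂ with C(1) = C₁. Assume: (i) Ψ₁ = B₀·a⁰₀; (ii) for every l ≥ 1 (with p := ⌊log₂ l⌋) and every k ≥ 0, Ψ_{2^{p+k+1}+l} = C_l·a¹_k; (iii) for every l ≥ 2, C_l = −⟨Ψ_l, Ψ₁⟩/conj(C₁). Then for every l ≥ 2 whose binary expansion is l = 2^{p} + 2^{p₁} + ⋯ + 2^{p_s} with p > p₁ > ⋯ > p_s ≥ 0 and s ≥ 1, and which is not of the form 2^k + 1 (i.e. it is not the case that s = 1 and p_s = 0), one has: C_l = C₁^{−(s−1)}·C_{2^{p−p₁}+1}·C_{2^{p₁−p₂}+1}⋯C_{2^{p_{s−2}−p_{s−1}}+1}·C_{2^{p_{s−1}}+1} if p_s = 0, and C_l = C₁^{−s}·C_{2^{p−p₁}+1}·C_{2^{p₁−p₂}+1}⋯C_{2^{p_{s−1}−p_s}+1}·C_{2^{p_s}}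 if p_s > 0. -/
open Finset

/-- `ℂ²` with its Euclidean structure. -/
abbrev E2 := EuclideanSpace ℂ (Fin 2)

/-- The inner product of `ℂ²`: `⟨u,v⟩ = u⁽¹⁾conj(v⁽¹⁾) + u⁽²⁾conj(v⁽²⁾)`. -/
noncomputable def cinner (u v : E2) : ℂ := ∑ i, u i * (starRingEnd ℂ) (v i)

theorem cinner_smul_left (c : ℂ) (u v : E2) : cinner (c • u) v = c * cinner u v := by
  simp [cinner, mul_add, mul_assoc]

/-- A sum of decreasing powers of two has the leading exponent as its binary logarithm. -/
theorem log_two_sum_pow (s : ℕ) (P : ℕ → ℕ) (hP : ∀ i, i < s → P (i + 1) < P i) :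
    Nat.log 2 (∑ i ∈ Finset.range (s + 1), 2 ^ P i) = P 0 := by
  have hlt : ∀ (s : ℕ) (P : ℕ → ℕ), (∀ i, i < s → P (i + 1) < P i) →
      ∑ i ∈ Finset.range (s + 1), 2 ^ P i < 2 ^ (P 0 + 1) := by
    intro s
    induction s with
    | zero => intro P _; simp [pow_succ]
    | succ s ih =>
      intro P hP
      have htail := ih (fun i => P (i + 1)) fun i hi => hP (i + 1) (by omega)
      have hpow : 2 ^ (P (0 + 1) + 1) ≤ 2 ^ P 0 :=
        Nat.pow_le_pow_right two_pos (hP 0 (by omega))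
      rw [Finset.sum_range_succ', pow_succ]
      omega
  refine Nat.log_eq_of_pow_le_of_lt_pow ?_ (hlt s P hP)
  rw [Finset.sum_range_succ']
  exact Nat.le_add_left _ _

/-- If prepending a leading binary digit to `l` multiplies `C l` by a factor depending only on the
gap between the exponents, then `C` factors along the binary expansion. -/
theorem pow_mul_apply_sum_pow {C : ℕ → ℂ}
    (hstep : ∀ l : ℕ, 1 ≤ l → ∀ q : ℕ, Nat.log 2 l < q →
      C 1 * C (2 ^ q + l) = C (2 ^ (q - Nat.log 2 l) + 1) * C l)
    (s : ℕ) (P : ℕ → ℕ) (hP : ∀ i, i < s → P (i + 1) < P i) :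
    C 1 ^ s * C (∑ i ∈ Finset.range (s + 1), 2 ^ P i) =
      (∏ i ∈ Finset.range s, C (2 ^ (P i - P (i + 1)) + 1)) * C (2 ^ P s) := by
  induction s generalizing P with
  | zero => simp
  | succ s ih =>
    have hP' : ∀ i, i < s → P (i + 1 + 1) < P (i + 1) := fun i hi => hP (i + 1) (by omega)
    have htail := ih (fun i => P (i + 1)) hP'
    have hlog := log_two_sum_pow s (fun i => P (i + 1)) hP'
    have hpos : 1 ≤ ∑ i ∈ Finset.range (s + 1), 2 ^ P (i + 1) := by
      rw [Finset.sum_range_succ']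
      exact le_add_left Nat.one_le_two_pow
    have hhead := hstep _ hpos (P 0) (by rw [hlog]; exact hP 0 (by omega))
    rw [hlog] at hhead
    rw [Finset.sum_range_succ', Finset.prod_range_succ', add_comm (∑ _ ∈ _, _), pow_succ, mul_assoc,
      hhead, mul_left_comm, htail]
    ring

theorem stmt5 (B₀ C₁ : ℂ) (hC₁ : C₁ ≠ 0)
    (a00 : E2) (a1 : ℕ → E2) (Ψ : ℕ → E2) (C : ℕ → ℂ)
    (hC1 : C 1 = C₁)
    (hΨ1 : Ψ 1 = B₀ • a00)
    (hΨl : ∀ l : ℕ, 1 ≤ l → ∀ k : ℕ,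
      Ψ (2 ^ (Nat.log 2 l + k + 1) + l) = C l • a1 k)
    (hCl : ∀ l : ℕ, 2 ≤ l → C l = -(cinner (Ψ l) (Ψ 1)) / (starRingEnd ℂ) C₁) :
    ∀ s : ℕ, 1 ≤ s → ∀ P : ℕ → ℕ,
      (∀ i, i < s → P (i + 1) < P i) →
      ¬(s = 1 ∧ P s = 0) →
      ((P s = 0 →
        C (∑ i ∈ Finset.range (s + 1), 2 ^ P i) =
          C₁ ^ (-((s : ℤ) - 1)) *
            (∏ i ∈ Finset.range (s - 1), C (2 ^ (P i - P (i + 1)) + 1)) *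
            C (2 ^ P (s - 1) + 1)) ∧
       (0 < P s →
        C (∑ i ∈ Finset.range (s + 1), 2 ^ P i) =
          C₁ ^ (-(s : ℤ)) *
            (∏ i ∈ Finset.range s, C (2 ^ (P i - P (i + 1)) + 1)) *
            C (2 ^ P s))) := by
  have hstep : ∀ l : ℕ, 1 ≤ l → ∀ q : ℕ, Nat.log 2 l < q →
      C 1 * C (2 ^ q + l) = C (2 ^ (q - Nat.log 2 l) + 1) * C l := by
    intro l hl q hq
    obtain ⟨k, rfl⟩ : ∃ k, q = Nat.log 2 l + k + 1 := ⟨q - Nat.log 2 l - 1, by omega⟩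
    have hgap : Nat.log 2 l + k + 1 - Nat.log 2 l = Nat.log 2 1 + k + 1 := by
      rw [Nat.log_one_right]; omega
    have hone : ∀ n : ℕ, 1 ≤ 2 ^ n := fun n => Nat.one_le_two_pow
    rw [hgap, hCl (2 ^ (Nat.log 2 l + k + 1) + l) (add_le_add (hone _) hl),
      hCl (2 ^ (Nat.log 2 1 + k + 1) + 1) (Nat.succ_le_succ (hone _)), hΨl l hl k,
      hΨl 1 le_rfl k, cinner_smul_left, cinner_smul_left]
    ring
  intro s hs P hP _
  have key := pow_mul_apply_sum_pow hstep s P hP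
  rw [hC1] at key
  refine ⟨fun h0 => ?_, fun _ => ?_⟩
  · obtain ⟨t, rfl⟩ : ∃ t, s = t + 1 := ⟨s - 1, by omega⟩
    rw [h0, pow_zero, hC1, Finset.prod_range_succ, h0, Nat.sub_zero, pow_succ, mul_right_comm] at key
    have key' := mul_right_cancel₀ hC₁ key
    rw [Nat.add_sub_cancel, mul_assoc, ← key']
    simp [hC₁]
  · rw [mul_assoc, ← key]
    simp [hC₁]
end

section
/- Let a⁰,a¹ : ℕ → ℂ² satisfy condition (A) and ‖a⁰₀‖ < 1, let B > 0, let B₀ ∈ ℂ with |B₀|² = B, and let C : {1,2,…} → ℂ (write C₁ := C(1)) satisfy: |C_{2^p}|² = B·(1 − ∑_{k=0}^{p} ‖a⁰_k‖²) for every p ≥ 0; |C_{2^p+1}|² = B·(1−‖a⁰₀‖²)·(1 − ∑_{k=0}^{p−1} ‖a¹_k‖²) for every p ≥ 1; C_{2^{p'}}·conj(C_{2^p}) = −B·∑_{r=0}^{p} ⟨a⁰_{p'−r}, a⁰_{p−r}⟩ for all 0 ≤ p < p'; C_{2^{p'}+1}·conj(C_{2^p+1}) = −B·(1−‖a⁰₀‖²)·∑_{r=0}^{p−1}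 ⟨a¹_{p'−r−1}, a¹_{p−r−1}⟩ for all 0 < p < p'; C_{2^{p'}+1}·conj(C_{2^p}) = −C₁·conj(B₀)·∑_{r=0}^{p} ⟨a¹_{p'−r−1}, a⁰_{p−r}⟩ for all 0 ≤ p < p' and = −C₁·conj(B₀)·∑_{r=0}^{p'−1} ⟨a¹_{p'−r−1}, a⁰_{p−r}⟩ for all 0 < p' ≤ p; and, for every l ≥ 2 with l₁ := l mod 2^{⌊log₂ l⌋} ≥ 1 (setting p := ⌊log₂ l⌋ and p₁ := ⌊log₂ l₁⌋), C_l = C_{2^{p−p₁}+1}·C_{l₁}/C₁. Define Ψ : ℕ → ℂ² by Ψ₀ := 0, Ψ_{2^k} := B₀·a⁰_k for k ≥ 0, and Ψ_{2^{p+k+1}+l} := C_l·a¹_k for every l ≥ 1, p := ⌊log₂ l⌋ and k ≥ 0, and define h_l and β_{l,l'} from Ψ and B as in the Hardy reformulation. Then for all l,l' ≥ 0 and every σ ∈ ℤ: ∑_{k=max(0,−σ)}^{∞} ⟨h_{l'}(k), h_l(k+σ)⟩ = β_{l,l'} if σ = 0 and = 0 otherwise. -/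
open Finset

/-- Condition (A): the matrix function with columns `∑ ω^k a0_k` and `∑ ω^k a1_k`
is an `M⁺`-inner matrix function, unitary a.e. on the circle. -/
def condA (a0 a1 : ℕ → E2) : Prop :=
  (∀ m : ℕ, (∑' k : ℕ, cinner (a0 (k + m)) (a0 k)) = if m = 0 then 1 else 0) ∧
  (∀ m : ℕ, (∑' k : ℕ, cinner (a1 (k + m)) (a1 k)) = if m = 0 then 1 else 0) ∧
  (∀ m : ℕ, (∑' k : ℕ, cinner (a0 (k + m)) (a1 k)) = 0) ∧
  (∀ m : ℕ, (∑' k : ℕ, cinner (a1 (k + m)) (a0 k)) = 0)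

/-- The sequences `h_l : ℕ → ℂ²` of the Hardy reformulation. -/
noncomputable def hseq (Ψ : ℕ → E2) (l k : ℕ) : E2 :=
  if l = 0 then Ψ (2 ^ k) else Ψ (2 ^ (Nat.log 2 l + k + 1) + l)

/-- The constants `β_{l,l'}` of the Hardy reformulation. -/
noncomputable def betaC (Ψ : ℕ → E2) (B : ℝ) (l l' : ℕ) : ℂ :=
  if l = 0 ∧ l' = 0 then (B : ℂ)
  else if l = 0 ∨ l' = 0 then 0
  else if l = l' then
    ((B - ∑ j ∈ Finset.range (Nat.log 2 l + 1), ‖Ψ (2 ^ j + l % 2 ^ j)‖ ^ 2 : ℝ) : ℂ)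
  else - ∑ t ∈ Finset.range (min (Nat.log 2 l) (Nat.log 2 l') + 1),
    if l / 2 ^ (Nat.log 2 l - min (Nat.log 2 l) (Nat.log 2 l') + t)
       = l' / 2 ^ (Nat.log 2 l' - min (Nat.log 2 l) (Nat.log 2 l') + t) then
      cinner
        (Ψ (2 ^ (Nat.log 2 l' - min (Nat.log 2 l) (Nat.log 2 l') + t)
           + l' % 2 ^ (Nat.log 2 l' - min (Nat.log 2 l) (Nat.log 2 l') + t)))
        (Ψ (2 ^ (Nat.log 2 l - min (Nat.log 2 l) (Nat.log 2 l') + t)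
           + l % 2 ^ (Nat.log 2 l - min (Nat.log 2 l) (Nat.log 2 l') + t)))
    else 0

theorem cinner_smul_smul (x y : ℂ) (u v : E2) :
    cinner (x • u) (y • v) = x * (starRingEnd ℂ) y * cinner u v := by
  simp only [cinner, Finset.mul_sum, PiLp.smul_apply, smul_eq_mul, map_mul]
  exact Finset.sum_congr rfl fun i _ => by ring

theorem cinner_conj (u v : E2) : (starRingEnd ℂ) (cinner u v) = cinner v u := by
  simp [cinner, mul_comm]

theorem cinner_self (u : E2) : cinner u u = ((‖u‖ ^ 2 : ℝ) : ℂ) := by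
  rw [EuclideanSpace.norm_sq_eq]
  simp [cinner, Complex.mul_conj']

/-- The cross-correlation of `u` and `v` at lag `σ` splits according to the sign of `σ`. -/
theorem tsum_correlation (u v : ℕ → E2) (σ : ℤ) :
    (∑' k : ℕ, cinner (u (k + (max 0 (-σ)).toNat))
        (v (((k : ℤ) + (max 0 (-σ)).toNat + σ).toNat)))
      = if 0 ≤ σ then (starRingEnd ℂ) (∑' k : ℕ, cinner (v (k + σ.toNat)) (u k))
        else ∑' k : ℕ, cinner (u (k + (-σ).toNat)) (v k) := by
  split_ifs with h
  · rw [Complex.conj_tsum]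
    refine tsum_congr fun k => ?_
    rw [cinner_conj]
    congr 2 <;> omega
  · refine tsum_congr fun k => ?_
    congr 2 <;> omega

/-- The sum over common binary prefixes of `l` and `l'` occurring in `betaC`, indexed by the
length of the prefix. -/
noncomputable def prefixSum (Ψ : ℕ → E2) (l l' : ℕ) : ℂ :=
  ∑ t ∈ Finset.range (min (Nat.log 2 l) (Nat.log 2 l') + 1),
    if l / 2 ^ (Nat.log 2 l - t) = l' / 2 ^ (Nat.log 2 l' - t) then
      cinner (Ψ (2 ^ (Nat.log 2 l' - t) + l' % 2 ^ (Nat.log 2 l' - t)))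
        (Ψ (2 ^ (Nat.log 2 l - t) + l % 2 ^ (Nat.log 2 l - t)))
    else 0

theorem prefixSum_conj (Ψ : ℕ → E2) (l l' : ℕ) :
    (starRingEnd ℂ) (prefixSum Ψ l l') = prefixSum Ψ l' l := by
  simp only [prefixSum, map_sum, min_comm (Nat.log 2 l')]
  refine Finset.sum_congr rfl fun t _ => ?_
  rw [apply_ite (starRingEnd ℂ), cinner_conj, map_zero]
  simp only [eq_comm]

theorem betaC_eq_sub_prefixSum (Ψ : ℕ → E2) (B : ℝ) {l l' : ℕ} (hl : l ≠ 0) (hl' : l' ≠ 0) :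
    betaC Ψ B l l' = (if l = l' then (B : ℂ) else 0) - prefixSum Ψ l l' := by
  simp only [betaC, hl, hl', false_and, false_or, if_false]
  split_ifs with h
  · subst h
    rw [prefixSum, ← Finset.sum_range_reflect]
    push_cast
    rw [min_self]
    congr 1
    refine Finset.sum_congr rfl fun t ht => ?_
    rw [Finset.mem_range] at ht
    rw [if_pos rfl, cinner_self]
    push_cast
    rfl
  · rw [prefixSum, zero_sub, ← Finset.sum_range_reflect]
    congr 1
    refine Finset.sum_congr rfl fun t ht => ?_
    rw [Finset.mem_range] at ht
    rw [show Nat.log 2 l - min (Nat.log 2 l) (Nat.log 2 l')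
          + (min (Nat.log 2 l) (Nat.log 2 l') + 1 - 1 - t) = Nat.log 2 l - t by omega,
      show Nat.log 2 l' - min (Nat.log 2 l) (Nat.log 2 l')
          + (min (Nat.log 2 l) (Nat.log 2 l') + 1 - 1 - t) = Nat.log 2 l' - t by omega]

theorem log_two_pow_add {p m : ℕ} (hm : m < 2 ^ p) : Nat.log 2 (2 ^ p + m) = p :=
  Nat.log_eq_of_pow_le_of_lt_pow (Nat.le_add_right _ _) (by rw [pow_succ]; omega)

theorem two_pow_add_div {p t : ℕ} (m : ℕ) (ht : t ≤ p) :
    (2 ^ p + m) / 2 ^ (p - t) = 2 ^ t + m / 2 ^ (p - t) := by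
  conv_lhs => rw [show (2 : ℕ) ^ p = 2 ^ (p - t) * 2 ^ t by rw [← pow_add]; congr 1; omega]
  exact Nat.mul_add_div (by positivity) _ _

theorem two_pow_add_mod {p t : ℕ} (m : ℕ) (ht : t ≤ p) :
    (2 ^ p + m) % 2 ^ (p - t) = m % 2 ^ (p - t) := by
  conv_lhs => rw [show (2 : ℕ) ^ p = 2 ^ (p - t) * 2 ^ t by rw [← pow_add]; congr 1; omega]
  exact Nat.mul_add_mod _ _ _

/-- Equality of binary prefixes passes to shorter prefixes. -/
theorem prefix_eq_mono {l l' p p' s t : ℕ} (hst : s ≤ t) (htp : t ≤ p) (htp' : t ≤ p')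
    (h : l / 2 ^ (p - t) = l' / 2 ^ (p' - t)) : l / 2 ^ (p - s) = l' / 2 ^ (p' - s) := by
  rw [show p - s = p - t + (t - s) by omega, show p' - s = p' - t + (t - s) by omega,
    pow_add, pow_add, ← Nat.div_div_eq_div_mul, ← Nat.div_div_eq_div_mul, h]

theorem sum_range_truncate {f g : ℕ → ℂ} {n N : ℕ} (hnN : n ≤ N) (hfg : ∀ t < n, f t = g t)
    (hf : ∀ t, n ≤ t → t < N → f t = 0) :
    ∑ t ∈ Finset.range N, f t = ∑ t ∈ Finset.range n, g t := by
  rw [← Finset.sum_range_add_sum_Ico f hnN,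
    Finset.sum_eq_zero (s := Finset.Ico n N) fun t ht => hf t (Finset.mem_Ico.1 ht).1
      (Finset.mem_Ico.1 ht).2, add_zero]
  exact Finset.sum_congr rfl fun t ht => hfg t (Finset.mem_range.1 ht)

theorem log_lt_of_lt_two_pow {p m : ℕ} (hm : m ≠ 0) (h : m < 2 ^ p) : Nat.log 2 m < p :=
  Nat.log_lt_of_lt_pow hm h

theorem lt_two_pow_of_log_lt {p m : ℕ} (h : Nat.log 2 m < p) : m < 2 ^ p :=
  Nat.lt_pow_of_log_lt (by norm_num) h

theorem div_two_pow_log {m : ℕ} (hm : m ≠ 0) : m / 2 ^ Nat.log 2 m = 1 := by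
  have h1 := Nat.pow_log_le_self 2 hm
  have h2 := Nat.lt_pow_succ_log_self (b := 2) (by norm_num) m
  rw [pow_succ] at h2
  exact Nat.div_eq_of_lt_le (by omega) (by omega)

/-- The prefixes of `2 ^ p + m` and `2 ^ p' + m'` differ once they reach the second binary digit
of `2 ^ p + m`, provided this comes before the second digit of `2 ^ p' + m'`. -/
theorem prefix_ne {p p' m m' t : ℕ} (hm : m ≠ 0) (hmp : m < 2 ^ p)
    (hg : m' < 2 ^ (p' - (p - Nat.log 2 m))) (ht : p - Nat.log 2 m ≤ t) (htp : t ≤ p)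
    (htp' : t ≤ p') : (2 ^ p + m) / 2 ^ (p - t) ≠ (2 ^ p' + m') / 2 ^ (p' - t) := by
  intro h
  have hlog := log_lt_of_lt_two_pow hm hmp
  have h := prefix_eq_mono ht htp htp' h
  rw [two_pow_add_div _ (by omega), two_pow_add_div _ (by omega), Nat.div_eq_of_lt hg,
    show p - (p - Nat.log 2 m) = Nat.log 2 m by omega, div_two_pow_log hm] at h
  omega

section

variable {a0 a1 Ψ : ℕ → E2} {C : ℕ → ℂ} {B₀ : ℂ}

theorem exists_eq_two_pow_add {l : ℕ} (hl : l ≠ 0) : ∃ p m, m < 2 ^ p ∧ l = 2 ^ p + m := by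
  have h1 := Nat.pow_log_le_self 2 hl
  have h2 := Nat.lt_pow_succ_log_self (b := 2) (by norm_num) l
  rw [pow_succ] at h2
  exact ⟨Nat.log 2 l, l - 2 ^ Nat.log 2 l, by omega, by omega⟩

theorem psi_two_pow_add
    (hΨl : ∀ l : ℕ, 1 ≤ l → ∀ k : ℕ, Ψ (2 ^ (Nat.log 2 l + k + 1) + l) = C l • a1 k)
    {j m : ℕ} (hm : m ≠ 0) (h : Nat.log 2 m < j) :
    Ψ (2 ^ j + m) = C m • a1 (j - Nat.log 2 m - 1) := by
  rw [← hΨl m (by omega)]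
  congr 3
  omega

theorem prefixSum_two_pow (hΨ2k : ∀ k : ℕ, Ψ (2 ^ k) = B₀ • a0 k) {p p' : ℕ} (hp : p ≤ p') :
    prefixSum Ψ (2 ^ p) (2 ^ p') = B₀ * (starRingEnd ℂ) B₀ *
      ∑ r ∈ Finset.range (p + 1), cinner (a0 (p' - r)) (a0 (p - r)) := by
  rw [prefixSum, Nat.log_pow (by norm_num), Nat.log_pow (by norm_num), min_eq_left hp,
    Finset.mul_sum]
  refine Finset.sum_congr rfl fun t ht => ?_
  rw [Finset.mem_range] at ht
  have d := two_pow_add_div (p := p) (t := t) 0 (by omega)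
  have d' := two_pow_add_div (p := p') (t := t) 0 (by omega)
  have e := two_pow_add_mod (p := p) (t := t) 0 (by omega)
  have e' := two_pow_add_mod (p := p') (t := t) 0 (by omega)
  simp only [add_zero, Nat.zero_div, Nat.zero_mod] at d d' e e'
  rw [d, d', e, e', if_pos rfl, add_zero, add_zero, hΨ2k, hΨ2k, cinner_smul_smul]

theorem prefixSum_two_pow_two_pow_add (hΨ2k : ∀ k : ℕ, Ψ (2 ^ k) = B₀ • a0 k)
    (hΨl : ∀ l : ℕ, 1 ≤ l → ∀ k : ℕ, Ψ (2 ^ (Nat.log 2 l + k + 1) + l) = C l • a1 k)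
    {p p' m' : ℕ} (hm' : m' ≠ 0) (hmp' : m' < 2 ^ p') :
    prefixSum Ψ (2 ^ p) (2 ^ p' + m') = C m' * (starRingEnd ℂ) B₀ *
      ∑ r ∈ Finset.range (min (p + 1) (p' - Nat.log 2 m')),
        cinner (a1 (p' - Nat.log 2 m' - r - 1)) (a0 (p - r)) := by
  have hlog := log_lt_of_lt_two_pow hm' hmp'
  rw [prefixSum, Nat.log_pow (by norm_num), log_two_pow_add hmp', Finset.mul_sum]
  refine sum_range_truncate (by omega) (fun t ht => ?_) fun t ht ht' => ?_
  · have hlt : m' < 2 ^ (p' - t) := lt_two_pow_of_log_lt (by omega)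
    have d := two_pow_add_div (p := p) (t := t) 0 (by omega)
    have e := two_pow_add_mod (p := p) (t := t) 0 (by omega)
    simp only [add_zero, Nat.zero_div, Nat.zero_mod] at d e
    have ht' : t ≤ p' := by omega
    rw [two_pow_add_div _ ht', two_pow_add_mod _ ht', Nat.div_eq_of_lt hlt,
      Nat.mod_eq_of_lt hlt, d, e, add_zero, add_zero, if_pos rfl, hΨ2k,
      psi_two_pow_add hΨl hm' (by omega), cinner_smul_smul,
      show p' - t - Nat.log 2 m' - 1 = p' - Nat.log 2 m' - t - 1 by omega]
  · refine if_neg fun h => ?_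
    exact prefix_ne (m' := 0) (p' := p) hm' hmp' (by positivity) (t := t) (by omega) (by omega)
      (by omega) h.symm

theorem prefixSum_of_gap_lt
    (hΨl : ∀ l : ℕ, 1 ≤ l → ∀ k : ℕ, Ψ (2 ^ (Nat.log 2 l + k + 1) + l) = C l • a1 k)
    {p p' m m' : ℕ} (hm : m ≠ 0) (hmp : m < 2 ^ p) (hm' : m' ≠ 0) (hmp' : m' < 2 ^ p')
    (hg : p - Nat.log 2 m < p' - Nat.log 2 m') :
    prefixSum Ψ (2 ^ p + m) (2 ^ p' + m') = C m' * (starRingEnd ℂ) (C m) *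
      ∑ r ∈ Finset.range (p - Nat.log 2 m),
        cinner (a1 (p' - Nat.log 2 m' - r - 1)) (a1 (p - Nat.log 2 m - r - 1)) := by
  have hlog := log_lt_of_lt_two_pow hm hmp
  have hlog' := log_lt_of_lt_two_pow hm' hmp'
  rw [prefixSum, log_two_pow_add hmp, log_two_pow_add hmp', Finset.mul_sum]
  refine sum_range_truncate (by omega) (fun t ht => ?_) fun t ht ht' => ?_
  · have hlt : m < 2 ^ (p - t) := lt_two_pow_of_log_lt (by omega)
    have hlt' : m' < 2 ^ (p' - t) := lt_two_pow_of_log_lt (by omega)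
    have ht₁ : t ≤ p := by omega
    have ht₂ : t ≤ p' := by omega
    rw [two_pow_add_div _ ht₁, two_pow_add_mod _ ht₁, two_pow_add_div _ ht₂,
      two_pow_add_mod _ ht₂, Nat.div_eq_of_lt hlt, Nat.mod_eq_of_lt hlt,
      Nat.div_eq_of_lt hlt', Nat.mod_eq_of_lt hlt', if_pos rfl,
      psi_two_pow_add hΨl hm (by omega), psi_two_pow_add hΨl hm' (by omega), cinner_smul_smul,
      show p' - t - Nat.log 2 m' - 1 = p' - Nat.log 2 m' - t - 1 by omega,
      show p - t - Nat.log 2 m - 1 = p - Nat.log 2 m - t - 1 by omega]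
  · exact if_neg (prefix_ne hm hmp (lt_two_pow_of_log_lt (by omega)) ht (by omega) (by omega))

theorem prefixSum_of_gap_eq
    (hΨl : ∀ l : ℕ, 1 ≤ l → ∀ k : ℕ, Ψ (2 ^ (Nat.log 2 l + k + 1) + l) = C l • a1 k)
    {p p' m m' : ℕ} (hm : m ≠ 0) (hmp : m < 2 ^ p) (hm' : m' ≠ 0) (hmp' : m' < 2 ^ p')
    (hg : p - Nat.log 2 m = p' - Nat.log 2 m') :
    prefixSum Ψ (2 ^ p + m) (2 ^ p' + m') = C m' * (starRingEnd ℂ) (C m) *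
      ((∑ r ∈ Finset.range (p - Nat.log 2 m), ‖a1 r‖ ^ 2 : ℝ) : ℂ) + prefixSum Ψ m m' := by
  have hlog := log_lt_of_lt_two_pow hm hmp
  have hlog' := log_lt_of_lt_two_pow hm' hmp'
  rw [prefixSum, log_two_pow_add hmp, log_two_pow_add hmp',
    show min p p' + 1 = (p - Nat.log 2 m) + (min (Nat.log 2 m) (Nat.log 2 m') + 1) by omega,
    Finset.sum_range_add]
  congr 1
  · push_cast
    rw [← Finset.sum_range_reflect fun r => (‖a1 r‖ : ℂ) ^ 2, Finset.mul_sum]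
    refine Finset.sum_congr rfl fun t ht => ?_
    rw [Finset.mem_range] at ht
    have hlt : m < 2 ^ (p - t) := lt_two_pow_of_log_lt (by omega)
    have hlt' : m' < 2 ^ (p' - t) := lt_two_pow_of_log_lt (by omega)
    have ht₁ : t ≤ p := by omega
    have ht₂ : t ≤ p' := by omega
    rw [two_pow_add_div _ ht₁, two_pow_add_mod _ ht₁, two_pow_add_div _ ht₂,
      two_pow_add_mod _ ht₂, Nat.div_eq_of_lt hlt, Nat.mod_eq_of_lt hlt,
      Nat.div_eq_of_lt hlt', Nat.mod_eq_of_lt hlt', if_pos rfl,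
      psi_two_pow_add hΨl hm (by omega), psi_two_pow_add hΨl hm' (by omega), cinner_smul_smul,
      show p' - t - Nat.log 2 m' - 1 = p - Nat.log 2 m - 1 - t by omega,
      show p - t - Nat.log 2 m - 1 = p - Nat.log 2 m - 1 - t by omega, cinner_self]
    push_cast
    rfl
  · rw [prefixSum]
    refine Finset.sum_congr rfl fun s hs => ?_
    rw [Finset.mem_range] at hs
    have ht₁ : p - Nat.log 2 m + s ≤ p := by omega
    have ht₂ : p - Nat.log 2 m + s ≤ p' := by omega
    rw [two_pow_add_div _ ht₁, two_pow_add_mod _ ht₁, two_pow_add_div _ ht₂,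
      two_pow_add_mod _ ht₂, show p - (p - Nat.log 2 m + s) = Nat.log 2 m - s by omega,
      show p' - (p - Nat.log 2 m + s) = Nat.log 2 m' - s by omega]
    simp only [Nat.add_left_cancel_iff]

end

theorem stmt6 (a0 a1 : ℕ → E2) (hA : condA a0 a1) (ha00 : ‖a0 0‖ < 1)
    (B : ℝ) (hB : 0 < B) (B₀ : ℂ) (hB₀ : ‖B₀‖ ^ 2 = B)
    (C : ℕ → ℂ)
    (hC2p : ∀ p : ℕ,
      ‖C (2 ^ p)‖ ^ 2 = B * (1 - ∑ k ∈ Finset.range (p + 1), ‖a0 k‖ ^ 2))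
    (hC2p1 : ∀ p : ℕ, 1 ≤ p →
      ‖C (2 ^ p + 1)‖ ^ 2
        = B * (1 - ‖a0 0‖ ^ 2) * (1 - ∑ k ∈ Finset.range p, ‖a1 k‖ ^ 2))
    (hC2c2 : ∀ p p' : ℕ, p < p' →
      C (2 ^ p') * (starRingEnd ℂ) (C (2 ^ p))
        = -(B : ℂ) * ∑ r ∈ Finset.range (p + 1), cinner (a0 (p' - r)) (a0 (p - r)))
    (hC21c21 : ∀ p p' : ℕ, 0 < p → p < p' →
      C (2 ^ p' + 1) * (starRingEnd ℂ) (C (2 ^ p + 1))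
        = -(B : ℂ) * ((1 - ‖a0 0‖ ^ 2 : ℝ) : ℂ) *
            ∑ r ∈ Finset.range p, cinner (a1 (p' - r - 1)) (a1 (p - r - 1)))
    (hC21c2a : ∀ p p' : ℕ, p < p' →
      C (2 ^ p' + 1) * (starRingEnd ℂ) (C (2 ^ p))
        = -(C 1 * (starRingEnd ℂ) B₀) *
            ∑ r ∈ Finset.range (p + 1), cinner (a1 (p' - r - 1)) (a0 (p - r)))
    (hC21c2b : ∀ p p' : ℕ, 0 < p' → p' ≤ p →
      C (2 ^ p' + 1) * (starRingEnd ℂ) (C (2 ^ p))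
        = -(C 1 * (starRingEnd ℂ) B₀) *
            ∑ r ∈ Finset.range p', cinner (a1 (p' - r - 1)) (a0 (p - r)))
    (hCrec : ∀ l : ℕ, 2 ≤ l → 1 ≤ l % 2 ^ Nat.log 2 l →
      C l = C (2 ^ (Nat.log 2 l - Nat.log 2 (l % 2 ^ Nat.log 2 l)) + 1) *
              C (l % 2 ^ Nat.log 2 l) / C 1)
    (Ψ : ℕ → E2)
    (hΨ0 : Ψ 0 = 0)
    (hΨ2k : ∀ k : ℕ, Ψ (2 ^ k) = B₀ • a0 k)
    (hΨl : ∀ l : ℕ, 1 ≤ l → ∀ k : ℕ,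
      Ψ (2 ^ (Nat.log 2 l + k + 1) + l) = C l • a1 k) :
    ∀ l l' : ℕ, ∀ σ : ℤ,
      (∑' k : ℕ,
        cinner (hseq Ψ l' (k + (max 0 (-σ)).toNat))
               (hseq Ψ l (((k : ℤ) + (max 0 (-σ)).toNat + σ).toNat)))
        = if σ = 0 then betaC Ψ B l l' else 0 := by
  obtain ⟨hA00, hA11, hA01, hA10⟩ := hA
  have hBB : B₀ * (starRingEnd ℂ) B₀ = (B : ℂ) := by
    rw [Complex.mul_conj', ← hB₀]; push_cast; rfl
  have hpos : 0 < 1 - ‖a0 0‖ ^ 2 := by nlinarith [norm_nonneg (a0 0)]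
  have hC1sq : C 1 * (starRingEnd ℂ) (C 1) = (B : ℂ) * ((1 - ‖a0 0‖ ^ 2 : ℝ) : ℂ) := by
    have h := hC2p 0
    simp only [pow_zero, zero_add, Finset.sum_range_one] at h
    rw [Complex.mul_conj', ← Complex.ofReal_pow, h]; push_cast; rfl
  have hC1 : C 1 ≠ 0 := by
    intro h
    rw [h, zero_mul, ← Complex.ofReal_mul, eq_comm, Complex.ofReal_eq_zero] at hC1sq
    exact (mul_pos hB hpos).ne' hC1sq
  have hC1c : (starRingEnd ℂ) (C 1) ≠ 0 := by simpa using hC1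
  have hCstep : ∀ p m : ℕ, m ≠ 0 → m < 2 ^ p →
      C (2 ^ p + m) = C (2 ^ (p - Nat.log 2 m) + 1) * C m / C 1 := by
    intro p m hm hmp
    have h := hCrec (2 ^ p + m)
    rw [log_two_pow_add hmp, Nat.add_mod_left, Nat.mod_eq_of_lt hmp] at h
    exact h (by omega) (by omega)
  -- the products `C l' * conj (C l)` reproduce the off-diagonal and diagonal constants
  have hsymm : ∀ l l' : ℕ,
      C l' * (starRingEnd ℂ) (C l) = (if l = l' then (B : ℂ) else 0) - prefixSum Ψ l l' →
      C l * (starRingEnd ℂ) (C l') = (if l' = l then (B : ℂ) else 0) - prefixSum Ψ l' l := by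
    intro l l' h
    have h := congrArg (starRingEnd ℂ) h
    rw [map_mul, map_sub, Complex.conj_conj, prefixSum_conj, mul_comm,
      apply_ite (starRingEnd ℂ), Complex.conj_ofReal, map_zero] at h
    simpa only [eq_comm] using h
  have hpow : ∀ p p' : ℕ, p ≤ p' → C (2 ^ p') * (starRingEnd ℂ) (C (2 ^ p))
      = (if 2 ^ p = 2 ^ p' then (B : ℂ) else 0) - prefixSum Ψ (2 ^ p) (2 ^ p') := by
    intro p p' hp
    rw [prefixSum_two_pow hΨ2k hp, hBB]
    rcases hp.eq_or_lt with rfl | hlt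
    · rw [if_pos rfl, Complex.mul_conj', ← Complex.ofReal_pow, hC2p,
        ← Finset.sum_range_reflect]
      simp only [cinner_self, Nat.add_sub_cancel]
      push_cast
      ring
    · rw [if_neg (Nat.pow_lt_pow_right (by norm_num) hlt).ne, hC2c2 p p' hlt]
      ring
  have hmixed : ∀ p p' m' : ℕ, m' ≠ 0 → m' < 2 ^ p' →
      C (2 ^ p' + m') * (starRingEnd ℂ) (C (2 ^ p))
        = (if 2 ^ p = 2 ^ p' + m' then (B : ℂ) else 0)
          - prefixSum Ψ (2 ^ p) (2 ^ p' + m') := by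
    intro p p' m' hm' hmp'
    have hlog := log_lt_of_lt_two_pow hm' hmp'
    have hne : 2 ^ p ≠ 2 ^ p' + m' := by
      intro h
      have hpp := congrArg (Nat.log 2) h
      rw [log_two_pow_add hmp', Nat.log_pow (by norm_num)] at hpp
      subst hpp
      omega
    rw [if_neg hne, prefixSum_two_pow_two_pow_add hΨ2k hΨl hm' hmp', hCstep p' m' hm' hmp']
    have hprod : C (2 ^ (p' - Nat.log 2 m') + 1) * (starRingEnd ℂ) (C (2 ^ p))
        = -(C 1 * (starRingEnd ℂ) B₀) *
          ∑ r ∈ Finset.range (min (p + 1) (p' - Nat.log 2 m')),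
            cinner (a1 (p' - Nat.log 2 m' - r - 1)) (a0 (p - r)) := by
      rcases lt_or_ge p (p' - Nat.log 2 m') with h | h
      · rw [hC21c2a _ _ h, min_eq_left h]
      · rw [hC21c2b _ _ (by omega) h, min_eq_right (by omega)]
    rw [show ∀ x y z w : ℂ, x * y / z * w = x * w * y / z from fun _ _ _ _ => by ring, hprod]
    field_simp
    ring
  have hgap : ∀ p p' m m' : ℕ, m ≠ 0 → m < 2 ^ p → m' ≠ 0 → m' < 2 ^ p' →
      p - Nat.log 2 m < p' - Nat.log 2 m' →
      C (2 ^ p' + m') * (starRingEnd ℂ) (C (2 ^ p + m))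
        = (if 2 ^ p + m = 2 ^ p' + m' then (B : ℂ) else 0)
          - prefixSum Ψ (2 ^ p + m) (2 ^ p' + m') := by
    intro p p' m m' hm hmp hm' hmp' hg
    have hlog := log_lt_of_lt_two_pow hm hmp
    have hne : 2 ^ p + m ≠ 2 ^ p' + m' := by
      intro h
      have hpp := congrArg (Nat.log 2) h
      rw [log_two_pow_add hmp, log_two_pow_add hmp'] at hpp
      subst hpp
      obtain rfl : m = m' := by omega
      exact hg.false
    rw [if_neg hne, prefixSum_of_gap_lt hΨl hm hmp hm' hmp' hg, hCstep p' m' hm' hmp',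
      hCstep p m hm hmp, map_div₀, map_mul]
    rw [show ∀ x y z x' y' z' : ℂ, x * y / z * (x' * y' / z') = x * x' * (y * y') / (z * z') from
      fun _ _ _ _ _ _ => by rw [div_mul_div_comm]; ring, hC21c21 _ _ (by omega) hg, neg_mul,
      ← hC1sq]
    field_simp
    ring
  have key : ∀ l l' : ℕ, l ≠ 0 → l' ≠ 0 →
      C l' * (starRingEnd ℂ) (C l) = (if l = l' then (B : ℂ) else 0) - prefixSum Ψ l l' := by
    intro l
    induction l using Nat.strong_induction_on with
    | _ l ih =>
    intro l' hl hl'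
    obtain ⟨p, m, hmp, rfl⟩ := exists_eq_two_pow_add hl
    obtain ⟨p', m', hmp', rfl⟩ := exists_eq_two_pow_add hl'
    by_cases hm : m = 0
    · subst hm
      by_cases hm' : m' = 0
      · subst hm'
        rcases le_total p p' with h | h
        · exact hpow p p' h
        · exact hsymm _ _ (hpow p' p h)
      · exact hmixed p p' m' hm' hmp'
    by_cases hm' : m' = 0
    · subst hm'
      exact hsymm _ _ (hmixed p' p m hm hmp)
    rcases lt_trichotomy (p - Nat.log 2 m) (p' - Nat.log 2 m') with hg | hg | hg
    · exact hgap p p' m m' hm hmp hm' hmp' hg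
    · have hlog := log_lt_of_lt_two_pow hm hmp
      have hlog' := log_lt_of_lt_two_pow hm' hmp'
      have hiff : 2 ^ p + m = 2 ^ p' + m' ↔ m = m' := by
        constructor
        · intro h
          have hpp := congrArg (Nat.log 2) h
          rw [log_two_pow_add hmp, log_two_pow_add hmp'] at hpp
          subst hpp
          omega
        · rintro rfl
          rw [show p = p' by omega]
      have hsq : C (2 ^ (p - Nat.log 2 m) + 1) *
          (starRingEnd ℂ) (C (2 ^ (p - Nat.log 2 m) + 1)) = C 1 * (starRingEnd ℂ) (C 1) *
            (1 - ((∑ r ∈ Finset.range (p - Nat.log 2 m), ‖a1 r‖ ^ 2 : ℝ) : ℂ)) := by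
        rw [Complex.mul_conj', ← Complex.ofReal_pow, hC2p1 _ (by omega), hC1sq]
        push_cast
        ring
      have hrec := ih m (by have := Nat.two_pow_pos p; omega) m' hm hm'
      rw [prefixSum_of_gap_eq hΨl hm hmp hm' hmp' hg, hCstep p' m' hm' hmp',
        hCstep p m hm hmp, ← hg, map_div₀, map_mul]
      rw [show ∀ x y z x' y' z' : ℂ, x * y / z * (x' * y' / z') = x * x' * (y * y') / (z * z')
        from fun _ _ _ _ _ _ => by rw [div_mul_div_comm]; ring, hsq, mul_assoc,
        mul_div_cancel_left₀ _ (mul_ne_zero hC1 hC1c)]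
      simp only [hiff]
      linear_combination hrec
    · exact hsymm _ _ (hgap p' p m' m hm' hmp' hm hmp hg)
  have hh0 : hseq Ψ 0 = fun k => B₀ • a0 k := by
    funext k; simp [hseq, hΨ2k]
  have hhl : ∀ l, l ≠ 0 → hseq Ψ l = fun k => C l • a1 k := by
    intro l hl
    funext k; rw [hseq, if_neg hl, hΨl l (by omega)]
  have htoNat : ∀ σ : ℤ, 0 ≤ σ → (σ.toNat = 0 ↔ σ = 0) := fun σ h => by omega
  have htoNat' : ∀ σ : ℤ, ¬ 0 ≤ σ → (-σ).toNat ≠ 0 ∧ σ ≠ 0 := fun σ h => by omega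
  intro l l' σ
  rw [tsum_correlation]
  by_cases hl : l = 0 <;> by_cases hl' : l' = 0
  · subst hl hl'
    simp only [hh0, cinner_smul_smul, tsum_mul_left, hA00, hBB, betaC, and_self, if_true]
    by_cases hσ : 0 ≤ σ
    · rw [if_pos hσ]
      simp only [htoNat σ hσ]
      split_ifs <;> simp
    · rw [if_neg hσ, if_neg (htoNat' σ hσ).1, if_neg (htoNat' σ hσ).2, mul_zero]
  · subst hl
    simp only [hh0, hhl l' hl', cinner_smul_smul, tsum_mul_left, hA01, hA10, betaC]
    simp [hl']
  · subst hl'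
    simp only [hh0, hhl l hl, cinner_smul_smul, tsum_mul_left, hA01, hA10, betaC]
    simp [hl]
  · rw [betaC_eq_sub_prefixSum Ψ B hl hl', ← key l l' hl hl']
    simp only [hhl l hl, hhl l' hl', cinner_smul_smul, tsum_mul_left, hA11]
    by_cases hσ : 0 ≤ σ
    · rw [if_pos hσ]
      simp only [htoNat σ hσ]
      split_ifs <;> simp [mul_comm]
    · rw [if_neg hσ, if_neg (htoNat' σ hσ).1, if_neg (htoNat' σ hσ).2, mul_zero]
end

section
/- Suppose a⁰,a¹ : ℕ → ℂ² satisfy condition (A) and conditions (C1)–(C5), and suppose a⁰₀ = 0. Then ‖a⁰₁‖ = 1, a⁰_k = 0 for every k ≠ 1, ‖a¹₀‖ = 1, a¹_k = 0 for every k ≥ 1, and ⟨a⁰₁, a¹₀⟩ = 0. (That is, the corresponding M⁺-inner matrix function is of Type 2: its columns are ω·u₀ and u₁ for an orthonormal basis u₀,u₁ of ℂ².) -/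
open Finset

/-- Conditions (C1)–(C5), with `d := 1 − ‖a0 0‖²`. -/
def condC (a0 a1 : ℕ → E2) : Prop :=
  (∀ p : ℕ, 1 ≤ p → ‖cinner (a0 p) (a0 0)‖ ^ 2
      = (1 - ‖a0 0‖ ^ 2) * (1 - ∑ k ∈ Finset.range (p + 1), ‖a0 k‖ ^ 2)) ∧
  (∀ p : ℕ, ‖cinner (a1 p) (a0 0)‖ ^ 2
      = (1 - ‖a0 0‖ ^ 2) * (1 - ∑ k ∈ Finset.range (p + 1), ‖a1 k‖ ^ 2)) ∧
  (∀ p p' : ℕ, 0 < p → p < p' →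
    cinner (a0 p') (a0 0) * cinner (a0 0) (a0 p)
      = -((1 - ‖a0 0‖ ^ 2 : ℝ) : ℂ) *
          ∑ r ∈ Finset.range (p + 1), cinner (a0 (p' - r)) (a0 (p - r))) ∧
  (∀ p p' : ℕ, p < p' →
    cinner (a1 p') (a0 0) * cinner (a0 0) (a1 p)
      = -((1 - ‖a0 0‖ ^ 2 : ℝ) : ℂ) *
          ∑ r ∈ Finset.range (p + 1), cinner (a1 (p' - r)) (a1 (p - r))) ∧
  (∀ p p' : ℕ, 0 < p → p ≤ p' →
    cinner (a1 p') (a0 0) * cinner (a0 0) (a0 p)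
      = -((1 - ‖a0 0‖ ^ 2 : ℝ) : ℂ) *
          ∑ r ∈ Finset.range (p + 1), cinner (a1 (p' - r)) (a0 (p - r))) ∧
  (∀ p p' : ℕ, p' < p →
    cinner (a1 p') (a0 0) * cinner (a0 0) (a0 p)
      = -((1 - ‖a0 0‖ ^ 2 : ℝ) : ℂ) *
          ∑ r ∈ Finset.range (p' + 1), cinner (a1 (p' - r)) (a0 (p - r)))

theorem stmt12 (a0 a1 : ℕ → E2) (hA : condA a0 a1) (hC : condC a0 a1)
    (h00 : a0 0 = 0) :
    ‖a0 1‖ = 1 ∧ (∀ k : ℕ, k ≠ 1 → a0 k = 0) ∧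
    ‖a1 0‖ = 1 ∧ (∀ k : ℕ, 1 ≤ k → a1 k = 0) ∧
    cinner (a0 1) (a1 0) = 0 := by
  obtain ⟨h1, h2, -, -, -, h5⟩ := hC
  have z (u : E2) : cinner u 0 = 0 := by simp [cinner]
  simp only [h00, z, norm_zero] at h1 h2 h5
  have s0 (p : ℕ) (hp : 1 ≤ p) : ∑ k ∈ Finset.range (p + 1), ‖a0 k‖ ^ 2 = 1 := by
    linarith [h1 p hp]
  have s1 (p : ℕ) : ∑ k ∈ Finset.range (p + 1), ‖a1 k‖ ^ 2 = 1 := by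
    linarith [h2 p]
  refine ⟨?_, fun k hk => ?_, ?_, fun k hk => ?_, ?_⟩
  · rw [← sq_eq_sq₀ (norm_nonneg _) zero_le_one]
    simpa [Finset.sum_range_succ, h00, -sq_eq_one_iff] using s0 1 le_rfl
  · rcases k with _ | _ | k
    · exact h00
    · exact absurd rfl hk
    · have h := s0 (k + 2) (by lia)
      rw [Finset.sum_range_succ, s0 (k + 1) (by lia)] at h
      simpa using h
  · rw [← sq_eq_sq₀ (norm_nonneg _) zero_le_one]
    simpa [-sq_eq_one_iff] using s1 0
  · obtain ⟨k, rfl⟩ := Nat.exists_eq_add_of_le' hk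
    have h := s1 (k + 1)
    rw [Finset.sum_range_succ, s1 k] at h
    simpa using h
  · have h : cinner (a1 0) (a0 1) = 0 := by simpa using h5 1 0 one_pos
    simpa [cinner, mul_comm] using congrArg (starRingEnd ℂ) h
end

section
/- Suppose a⁰,a¹ : ℕ → ℂ² satisfy condition (A) and conditions (C1)–(C5), and suppose 0 < ‖a⁰₀‖ < 1. Then it is impossible that both ⟨a⁰₁, a⁰₀⟩ = 0 and ⟨a¹₀, a⁰₀⟩ = 0; i.e., at least one of ⟨a⁰₁, a⁰₀⟩ ≠ 0 or ⟨a¹₀, a⁰₀⟩ ≠ 0 holds. (In the paper's notation: the coefficients C₂ and C₃ cannot both vanish.) -/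
open Finset

theorem cinner_eq_inner (u v : E2) : cinner u v = inner ℂ v u := by
  simp [cinner, PiLp.inner_apply]

/-- Three pairwise orthogonal vectors of `ℂ²` cannot all be nonzero. -/
theorem eq_zero_of_pairwise_cinner_eq_zero {x y z : E2} (hx : x ≠ 0) (hy : y ≠ 0)
    (hyx : cinner y x = 0) (hzx : cinner z x = 0) (hzy : cinner z y = 0) : z = 0 := by
  by_contra hz
  rw [cinner_eq_inner] at hyx hzx hzy
  have hli : LinearIndependent ℂ ![x, y, z] := by
    refine linearIndependent_of_ne_zero_of_inner_eq_zero ?_ ?_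
    · intro i
      fin_cases i <;> simpa
    · intro i j hij
      fin_cases i <;> fin_cases j <;>
        first
        | exact absurd rfl hij
        | simpa using hyx
        | simpa using hzx
        | simpa using hzy
        | simpa using inner_eq_zero_symm.mp hyx
        | simpa using inner_eq_zero_symm.mp hzx
        | simpa using inner_eq_zero_symm.mp hzy
  have hcard := hli.fintype_card_le_finrank
  simp at hcard

theorem stmt13 (a0 a1 : ℕ → E2) (hA : condA a0 a1) (hC : condC a0 a1)
    (h00 : 0 < ‖a0 0‖) (h01 : ‖a0 0‖ < 1) :
    ¬(cinner (a0 1) (a0 0) = 0 ∧ cinner (a1 0) (a0 0) = 0) := by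
  rintro ⟨h10, hb0⟩
  obtain ⟨hC1, hC2, -, -, -, hC5⟩ := hC
  have hd : 0 < 1 - ‖a0 0‖ ^ 2 := by nlinarith
  have hd' : ((1 - ‖a0 0‖ ^ 2 : ℝ) : ℂ) ≠ 0 := Complex.ofReal_ne_zero.mpr hd.ne'
  have hy := hC1 1 le_rfl
  have hz := hC2 0
  have hzy := hC5 1 0 one_pos
  simp only [h10, hb0, sum_range_succ, range_zero, sum_empty, zero_add, norm_zero, zero_mul,
    Nat.sub_zero, ne_eq, OfNat.ofNat_ne_zero, not_false_eq_true, zero_pow] at hy hz hzy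
  have hy1 := (mul_eq_zero.mp hy.symm).resolve_left hd.ne'
  have hz1 := (mul_eq_zero.mp hz.symm).resolve_left hd.ne'
  have hzy0 := (mul_eq_zero.mp hzy.symm).resolve_left (neg_ne_zero.mpr hd')
  have hyne : a0 1 ≠ 0 := by
    intro h
    rw [h, norm_zero] at hy1
    linarith
  have hz0 := eq_zero_of_pairwise_cinner_eq_zero (norm_pos_iff.mp h00) hyne h10 hb0 hzy0
  rw [hz0, norm_zero] at hz1
  norm_num at hz1
end
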